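/- Let n, k, r, m be positive integers with r ≥ 2, n > 36k(2k+1)(k+r)r and C(n,k) − C(n−r+1,k) < m ≤ C(n,k) − C(n−r,k). Suppose 𝓕 ⊆ ([n] choose k) has |𝓕| = m, 𝓕 is extremal (ω(𝓕') ≤ ω(𝓕) for every 𝓕' ⊆ ([n] choose k) with |𝓕'| = m), and 𝓕 contains no full star. Then the set X₀ := {x ∈ [n] : |𝓕(x)| ≥ m/(3kr)} is a cover of 𝓕, i.e., F ∩ X₀ ≠ ∅ for every F ∈ 𝓕. -/

import Mathlib

open Finset

/-- `ω(𝓕)`: the sum of `|A ∩ B|` over unordered pairs of distinct members of `𝓕`. -/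
def omegaF (F : Finset (Finset ℕ)) : ℕ :=
  ∑ p ∈ F.sym2.filter (fun p => ¬ p.IsDiag),
    Sym2.lift ⟨fun A B => (A ∩ B).card, fun A B => by simp [Finset.inter_comm]⟩ p

/-- `ω(𝓕, 𝓖)`: the sum of `|A ∩ B|` over all ordered pairs `(A, B) ∈ 𝓕 × 𝓖`. -/
def omegaPair (F G : Finset (Finset ℕ)) : ℕ :=
  ∑ A ∈ F, ∑ B ∈ G, (A ∩ B).card

/-- `ω(F, 𝓕)`: the sum of `|F ∩ A|` over all `A ∈ 𝓕`. -/
def omegaSet (F : Finset ℕ) (G : Finset (Finset ℕ)) : ℕ :=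
  ∑ A ∈ G, (F ∩ A).card

/-- `A` precedes `B` in the lexicographic ordering: `min (A \ B) < min (B \ A)`. -/
def lexLT (A B : Finset ℕ) : Prop :=
  (A \ B).min < (B \ A).min

/-- `L` consists of the first `m` sets of `([n] choose k)` in the lexicographic
ordering: it is an `m`-element subfamily all of whose members lexicographically
precede all non-members. -/
def IsInitSeg (n k m : ℕ) (L : Finset (Finset ℕ)) : Prop :=
  L ⊆ (Finset.Icc 1 n).powersetCard k ∧ L.card = m ∧
    ∀ A ∈ L, ∀ B ∈ (Finset.Icc 1 n).powersetCard k, B ∉ L → lexLT A B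

/-- The `(n,k)`-cascade end of `m` is at most `r`: writing
`C(n,k) - m = C(n-r₁,k) + C(n-r₂,k-1) + ⋯ + C(n-rₛ,k-s+1)` in `k`-cascade form
with `1 ≤ r₁ < ⋯ < rₛ ≤ n-1`, one has `rₛ ≤ r`. -/
def CascadeEndLe (n k m r : ℕ) : Prop :=
  ∃ (s : ℕ) (f : Fin (s + 1) → ℕ),
    s + 1 ≤ k ∧ StrictMono f ∧ 1 ≤ f 0 ∧ f (Fin.last s) ≤ n - 1 ∧
    (∀ i : Fin (s + 1), k - (i : ℕ) ≤ n - f i) ∧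
    f (Fin.last s) ≤ r ∧
    n.choose k - m = ∑ i : Fin (s + 1), (n - f i).choose (k - (i : ℕ))

/-- degree of a vertex -/
def hdDeg (F : Finset (Finset ℕ)) (x : ℕ) : ℕ := (F.filter (fun B => x ∈ B)).card

theorem hd_omega_insert (F : Finset (Finset ℕ)) (a : Finset ℕ) (ha : a ∉ F) :
    omegaF (insert a F) = omegaF F + ∑ B ∈ F, (a ∩ B).card := by
  unfold omegaF
  have h1 : (insert a F).sym2.filter (fun p => ¬ p.IsDiag)
      = F.sym2.filter (fun p => ¬ p.IsDiag) ∪ F.image (fun b => s(a, b)) := by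
    ext p
    induction p using Sym2.ind with
    | _ x y =>
      simp only [mem_filter, mk_mem_sym2_iff, mem_insert, Sym2.isDiag_iff_proj_eq, mem_union,
        mem_image, Sym2.eq_iff]
      grind
  rw [h1, sum_union, sum_image]
  · simp
  · intro x hx y hy h
    simp only [Sym2.eq_iff] at h
    grind
  · rw [disjoint_left]
    intro p
    induction p using Sym2.ind with
    | _ x y =>
      simp only [mem_filter, mk_mem_sym2_iff, mem_image, Sym2.eq_iff]
      grind

theorem hd_sum_inter (B : Finset ℕ) (F : Finset (Finset ℕ)) :
    ∑ C ∈ F, (B ∩ C).card = ∑ x ∈ B, hdDeg F x := by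
  unfold hdDeg
  have := Finset.sum_card_bipartiteAbove_eq_sum_card_bipartiteBelow
    (s := B) (t := F) (fun (x : ℕ) (C : Finset ℕ) => x ∈ C)
  simp only [bipartiteAbove, bipartiteBelow] at this
  rw [this]
  apply sum_congr rfl
  intro C _
  rw [filter_mem_eq_inter]

theorem hd_two_omega (F : Finset (Finset ℕ)) :
    2 * omegaF F + ∑ A ∈ F, A.card = ∑ A ∈ F, ∑ B ∈ F, (A ∩ B).card := by
  induction F using Finset.induction_on with
  | empty => simp [omegaF]
  | insert a F ha ih =>
    rw [hd_omega_insert _ _ ha, sum_insert ha, sum_insert ha, sum_insert ha]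
    have : ∑ A ∈ F, ∑ B ∈ insert a F, (A ∩ B).card
        = ∑ B ∈ F, (a ∩ B).card + ∑ A ∈ F, ∑ B ∈ F, (A ∩ B).card := by
      rw [← sum_add_distrib]
      apply sum_congr rfl
      intro A _
      rw [sum_insert ha, inter_comm]
    rw [this, inter_self]
    omega

theorem hd_sum_sq (n k : ℕ) (F : Finset (Finset ℕ))
    (hF : F ⊆ (Finset.Icc 1 n).powersetCard k) :
    2 * omegaF F + k * F.card = ∑ x ∈ Icc 1 n, hdDeg F x ^ 2 := by
  have h1 : ∑ A ∈ F, A.card = k * F.card := by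
    rw [sum_congr rfl (fun A hA => (mem_powersetCard.1 (hF hA)).2)]
    simp [mul_comm]
  rw [← h1, hd_two_omega]
  simp_rw [hd_sum_inter]
  have h2 : ∀ A ∈ F, ∑ x ∈ A, hdDeg F x
      = ∑ x ∈ Icc 1 n, if x ∈ A then hdDeg F x else 0 := by
    intro A hA
    have hs := (mem_powersetCard.1 (hF hA)).1
    rw [← sum_filter, filter_mem_eq_inter, inter_eq_right.2 hs]
  rw [sum_congr rfl h2, sum_comm]
  apply sum_congr rfl
  intro x _
  rw [← sum_filter, sum_const, smul_eq_mul, pow_two, hdDeg]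

theorem hd_sum_deg (n k : ℕ) (F : Finset (Finset ℕ))
    (hF : F ⊆ (Finset.Icc 1 n).powersetCard k) :
    ∑ x ∈ Icc 1 n, hdDeg F x = k * F.card := by
  rw [← hd_sum_inter]
  have h2 : ∀ A ∈ F, (Icc 1 n ∩ A).card = k := by
    intro A hA
    have hs := (mem_powersetCard.1 (hF hA))
    rw [inter_eq_right.2 hs.1, hs.2]
  rw [sum_congr rfl h2]
  simp [mul_comm]

theorem hd_exchange (n k m : ℕ) (F : Finset (Finset ℕ))
    (hF : F ⊆ (Finset.Icc 1 n).powersetCard k) (hc : F.card = m)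
    (hext : ∀ F' ⊆ (Finset.Icc 1 n).powersetCard k, F'.card = m → omegaF F' ≤ omegaF F)
    (A B : Finset ℕ) (hA : A ∈ F) (hB : B ∈ (Finset.Icc 1 n).powersetCard k) (hBF : B ∉ F) :
    ∑ x ∈ B, hdDeg F x ≤ ∑ x ∈ A, hdDeg F x := by
  have hBe : B ∉ F.erase A := fun h => hBF (mem_of_mem_erase h)
  have h1 := hext (insert B (F.erase A))
    (insert_subset hB ((erase_subset _ _).trans hF))
    (by rw [card_insert_of_notMem hBe, card_erase_of_mem hA, hc]
        have := card_pos.2 ⟨A, hA⟩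
        omega)
  have h2 := hd_omega_insert (F.erase A) A (notMem_erase A F)
  rw [hd_omega_insert _ _ hBe] at h1
  rw [insert_erase hA] at h2
  rw [← hd_sum_inter, ← hd_sum_inter, ← add_sum_erase F _ hA, ← add_sum_erase F _ hA]
  have h3 : (B ∩ A).card ≤ (A ∩ A).card := card_le_card (by simp)
  omega

theorem hd_pair_count (n k : ℕ) (F : Finset (Finset ℕ))
    (hF : F ⊆ (Finset.Icc 1 n).powersetCard (k + 2)) (x y : ℕ) (hxy : x ≠ y)
    (hx : x ∈ Icc 1 n) (hy : y ∈ Icc 1 n) :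
    (F.filter (fun A => x ∈ A ∧ y ∈ A)).card ≤ (n - 2).choose k := by
  have hcard : (((Icc 1 n).erase x).erase y).card = n - 2 := by
    rw [card_erase_of_mem (by simp [hxy.symm, mem_erase] at *; exact hy),
      card_erase_of_mem hx]
    simp; omega
  rw [← hcard, ← card_powersetCard]
  apply card_le_card_of_injOn (fun A => (A.erase x).erase y)
  · intro A hA
    simp only [coe_filter, Set.mem_setOf_eq] at hA
    obtain ⟨hAF, hxA, hyA⟩ := hA
    have hs := mem_powersetCard.1 (hF hAF)
    simp only [mem_coe, mem_powersetCard]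
    refine ⟨erase_subset_erase _ (erase_subset_erase _ hs.1), ?_⟩
    rw [card_erase_of_mem (mem_erase.2 ⟨hxy.symm, hyA⟩), card_erase_of_mem hxA, hs.2]
    omega
  · intro A hA B hB h
    simp only [coe_filter, Set.mem_setOf_eq] at hA hB
    simp only at h
    ext z
    have := congrArg (fun S => z ∈ S) h
    simp only [mem_erase, eq_iff_iff] at this
    grind

theorem hd_bonferroni (n k : ℕ) (F : Finset (Finset ℕ))
    (hF : F ⊆ (Finset.Icc 1 n).powersetCard (k + 2)) (Y : Finset ℕ) (hY : Y ⊆ Icc 1 n) :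
    2 * ∑ x ∈ Y, hdDeg F x ≤ 2 * F.card + Y.card ^ 2 * (n - 2).choose k := by
  rw [← hd_sum_inter]
  have h1 : ∀ A ∈ F, 2 * (Y ∩ A).card ≤ 2 + (Y ∩ A).offDiag.card := by
    intro A _
    rw [offDiag_card]
    rcases h : (Y ∩ A).card with _ | c
    · simp
    · have : (c + 1) * (c + 1) - (c + 1) = (c + 1) * c := by
        rw [Nat.mul_succ]; omega
      rw [this]
      rcases c with _ | c
      · simp
      · nlinarith
  rw [mul_sum]
  refine (sum_le_sum h1).trans ?_
  rw [sum_add_distrib, sum_const, smul_eq_mul, mul_comm]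
  gcongr
  have h2 : ∀ A ∈ F, (Y ∩ A).offDiag.card
      = (Y.offDiag.filter (fun p => p.1 ∈ A ∧ p.2 ∈ A)).card := by
    intro A _
    congr 1
    ext p
    simp only [mem_offDiag, mem_inter, mem_filter]
    tauto
  rw [sum_congr rfl h2]
  have := Finset.sum_card_bipartiteAbove_eq_sum_card_bipartiteBelow
    (s := Y.offDiag) (t := F) (fun (p : ℕ × ℕ) (A : Finset ℕ) => p.1 ∈ A ∧ p.2 ∈ A)
  simp only [bipartiteAbove, bipartiteBelow] at this
  rw [← this]
  refine (sum_le_card_nsmul _ _ ((n - 2).choose k) ?_).trans ?_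
  · intro p hp
    rw [mem_offDiag] at hp
    exact hd_pair_count n k F hF p.1 p.2 hp.2.2 (hY hp.1) (hY hp.2.1)
  · rw [smul_eq_mul, offDiag_card, pow_two]
    gcongr
    omega

theorem hd_choose_lower (M k j : ℕ) :
    M.choose (k + 1) + j * M.choose k ≤ (M + j).choose (k + 1) := by
  induction j with
  | zero => simp
  | succ j ih =>
    rw [← add_assoc, Nat.choose_succ_succ]
    have := Nat.choose_le_choose k (Nat.le_add_right M j)
    simp only [Nat.succ_eq_add_one]
    nlinarith

theorem hd_choose_upper (M k j N : ℕ) (hN : M + j ≤ N + 1) :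
    (M + j).choose (k + 1) ≤ M.choose (k + 1) + j * N.choose k := by
  induction j with
  | zero => simp
  | succ j ih =>
    have ih := ih (by omega)
    rw [← add_assoc, Nat.choose_succ_succ]
    have := Nat.choose_le_choose k (show M + j ≤ N by omega)
    simp only [Nat.succ_eq_add_one]
    nlinarith

theorem hd_m_large (n k r m : ℕ) (hr : 2 ≤ r)
    (hbig : 36 * (k + 2) * (2 * (k + 2) + 1) * ((k + 2) + r) * r < n)
    (hm1 : n.choose (k + 2) - (n - r + 1).choose (k + 2) < m) :
    18 * (k + 2) ^ 2 * r ^ 2 * (n - 2).choose k < m := by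
  have hrn : r + 2 ≤ n := by
    have : 1 * (r + 2) * 1 ≤ (36 * (k + 2) * (2 * (k + 2) + 1)) * ((k + 2) + r) * r := by
      refine Nat.mul_le_mul (Nat.mul_le_mul ?_ ?_) ?_
      · nlinarith
      · omega
      · omega
    omega
  obtain ⟨s, rfl⟩ : ∃ s, r = s + 2 := ⟨r - 2, by omega⟩
  obtain ⟨N, rfl⟩ : ∃ N, n = N + s + 2 := ⟨n - s - 2, by omega⟩
  have e1 : N + s + 2 - (s + 2) + 1 = N + 1 := by omega
  have e2 : N + s + 2 - 2 = N + s := by omega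
  rw [e1] at hm1
  rw [e2]
  have h1 := hd_choose_lower (N + 1) (k + 1) (s + 1)
  have h2 := hd_choose_upper (N + 1) k s (N + s) (by omega)
  have h3 := Nat.add_one_mul_choose_eq (N + s) k
  have e3 : N + 1 + (s + 1) = N + s + 2 := by omega
  have e4 : N + 1 + s = N + s + 1 := by omega
  rw [e3] at h1
  rw [e4] at h2
  have e5 : k + 1 + 1 = k + 2 := rfl
  rw [e5] at h1
  generalize (N + s).choose k = P at *
  generalize (N + s + 1).choose (k + 1) = S at *
  generalize (N + 1).choose (k + 1) = Q at *
  have h4 : (s + 1) * Q < m := by omega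
  have hnP : 72 * (k + 2) ^ 2 * (k + 2 + (s + 2)) * (s + 2) * P ≤ (k + 2) * S := by
    have : 72 * (k + 2) ^ 2 * (k + 2 + (s + 2)) * (s + 2) ≤ N + s + 1 := by
      refine le_trans ?_ (Nat.lt_succ_iff.1 hbig)
      have : 72 * (k + 2) ^ 2 ≤ 36 * (k + 2) * (2 * (k + 2) + 1) := by nlinarith
      gcongr
    calc _ ≤ (N + s + 1) * P := by gcongr
      _ = S * (k + 1) := h3
      _ ≤ _ := by nlinarith
  have hSP : 72 * (k + 2) * (k + 2 + (s + 2)) * (s + 2) * P ≤ S := by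
    apply Nat.le_of_mul_le_mul_left (c := _) _ (show 0 < k + 2 by omega)
    calc _ = _ := by ring
      _ ≤ _ := hnP
  have hQ : 36 * (k + 2) * (k + 2) * (s + 2) * P ≤ Q := by
    have : 36 * (k + 2) * (k + 2) * (s + 2) * P + s * P
        ≤ 72 * (k + 2) * (k + 2 + (s + 2)) * (s + 2) * P := by
      rw [← add_mul]
      gcongr
      nlinarith [Nat.zero_le (k * s), Nat.zero_le (k * k * s), Nat.zero_le (k*s*s), Nat.zero_le (k*k)]
    omega
  calc 18 * (k + 2) ^ 2 * (s + 2) ^ 2 * P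
      = (s + 2) * (18 * (k + 2) * (k + 2) * (s + 2) * P) := by ring
    _ ≤ (2 * (s + 1)) * (18 * (k + 2) * (k + 2) * (s + 2) * P) := by gcongr; omega
    _ = (s + 1) * (36 * (k + 2) * (k + 2) * (s + 2) * P) := by ring
    _ ≤ (s + 1) * Q := by gcongr
    _ < m := h4

theorem hd_lower (n k r m : ℕ) (hrn : r ≤ n)
    (hm2 : m ≤ n.choose k - (n - r).choose k) :
    ∃ F' ⊆ (Finset.Icc 1 n).powersetCard k, F'.card = m ∧
      m ^ 2 ≤ r * ∑ x ∈ Icc 1 n, hdDeg F' x ^ 2 := by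
  have hsub : (Icc (r + 1) n).powersetCard k ⊆ (Icc 1 n).powersetCard k :=
    powersetCard_mono (Icc_subset_Icc (by omega) le_rfl)
  have hc : m ≤ ((Icc 1 n).powersetCard k \ (Icc (r + 1) n).powersetCard k).card := by
    rw [card_sdiff_of_subset hsub]
    simp only [card_powersetCard, Nat.card_Icc]
    have e1 : n + 1 - 1 = n := by omega
    have e2 : n + 1 - (r + 1) = n - r := by omega
    rw [e1, e2]
    exact hm2
  obtain ⟨F', hF', hF'c⟩ := exists_subset_card_eq hc
  have hF's : F' ⊆ (Icc 1 n).powersetCard k := hF'.trans sdiff_subset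
  refine ⟨F', hF's, hF'c, ?_⟩
  have h1 : m ≤ ∑ x ∈ Icc 1 r, hdDeg F' x := by
    rw [← hd_sum_inter, ← hF'c, card_eq_sum_ones]
    apply sum_le_sum
    intro A hA
    have h := hF' hA
    rw [mem_sdiff, mem_powersetCard, mem_powersetCard] at h
    rw [Nat.one_le_iff_ne_zero, Ne, card_eq_zero]
    intro he
    apply h.2
    refine ⟨?_, h.1.2⟩
    intro x hx
    have h3 := mem_Icc.1 (h.1.1 hx)
    have h4 : x ∉ Icc 1 r ∩ A := by rw [he]; simp
    simp only [mem_inter, mem_Icc, hx, and_true] at h4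
    rw [mem_Icc]
    omega
  calc m ^ 2 ≤ (∑ x ∈ Icc 1 r, hdDeg F' x) ^ 2 := by gcongr
    _ ≤ (Icc 1 r).card * ∑ x ∈ Icc 1 r, hdDeg F' x ^ 2 := sq_sum_le_card_mul_sum_sq
    _ = r * ∑ x ∈ Icc 1 r, hdDeg F' x ^ 2 := by simp
    _ ≤ _ := by
      gcongr

theorem hd_main (n k r m : ℕ) (hr : 2 ≤ r) (hm : 0 < m)
    (hbig : 36 * (k + 2) * (2 * (k + 2) + 1) * ((k + 2) + r) * r < n)
    (hm1 : n.choose (k + 2) - (n - r + 1).choose (k + 2) < m)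
    (hm2 : m ≤ n.choose (k + 2) - (n - r).choose (k + 2))
    (F : Finset (Finset ℕ)) (hFsub : F ⊆ (Finset.Icc 1 n).powersetCard (k + 2))
    (hFcard : F.card = m)
    (hext : ∀ F' ⊆ (Finset.Icc 1 n).powersetCard (k + 2), F'.card = m → omegaF F' ≤ omegaF F)
    (hnostar : ∀ x ∈ Finset.Icc 1 n, ∃ B ∈ (Finset.Icc 1 n).powersetCard (k + 2), x ∈ B ∧ B ∉ F)
    (A : Finset ℕ) (hA : A ∈ F) (hlow : ∀ x ∈ A, 3 * (k + 2) * r * hdDeg F x < m) : False := by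
  have hAc := (mem_powersetCard.1 (hFsub hA))
  have hAsum : 3 * r * ∑ x ∈ A, hdDeg F x ≤ m := by
    have : ∑ x ∈ A, 3 * (k + 2) * r * hdDeg F x ≤ A.card • m :=
      sum_le_card_nsmul _ _ _ (fun x hx => (hlow x hx).le)
    rw [← mul_sum, hAc.2, smul_eq_mul] at this
    apply Nat.le_of_mul_le_mul_left (c := _) _ (show 0 < k + 2 by omega)
    calc _ = _ := by ring
      _ ≤ _ := this
  have hdeg : ∀ x ∈ Icc 1 n, 3 * r * hdDeg F x ≤ m := by
    intro x hx
    obtain ⟨B, hB, hxB, hBF⟩ := hnostar x hx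
    have h1 := hd_exchange n (k + 2) m F hFsub hFcard hext A B hA hB hBF
    have h2 : hdDeg F x ≤ ∑ x ∈ B, hdDeg F x :=
      single_le_sum (f := hdDeg F) (fun _ _ => Nat.zero_le _) hxB
    exact (Nat.mul_le_mul_left _ (h2.trans h1)).trans hAsum
  have hml := hd_m_large n k r m hr hbig hm1
  -- sums over at most 6kr vertices are less than 2m
  have hsmall : ∀ Y ⊆ Icc 1 n, Y.card ≤ 6 * (k + 2) * r → ∑ x ∈ Y, hdDeg F x < 2 * m := by
    intro Y hY hYc
    have h1 := hd_bonferroni n k F hFsub Y hY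
    have h2 : Y.card ^ 2 * (n - 2).choose k ≤ (6 * (k + 2) * r) ^ 2 * (n - 2).choose k := by
      gcongr
    have h3 : (6 * (k + 2) * r) ^ 2 * (n - 2).choose k
        = 2 * (18 * (k + 2) ^ 2 * r ^ 2 * (n - 2).choose k) := by ring
    rw [hFcard] at h1
    omega
  set X := (Icc 1 n).filter (fun x => m ≤ 3 * (k + 2) * r * hdDeg F x) with hX
  have hXs : X ⊆ Icc 1 n := filter_subset _ _
  have hXsum : ∑ x ∈ X, hdDeg F x < 2 * m := by
    rcases le_total X.card (6 * (k + 2) * r) with h | h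
    · exact hsmall X hXs h
    · exfalso
      obtain ⟨Y, hYX, hYc⟩ := exists_subset_card_eq h
      have h1 := hsmall Y (hYX.trans hXs) hYc.le
      have h2 : Y.card • m ≤ ∑ x ∈ Y, 3 * (k + 2) * r * hdDeg F x :=
        card_nsmul_le_sum _ _ _ (fun x hx => (mem_filter.1 (hYX hx)).2)
      rw [← mul_sum, hYc, smul_eq_mul] at h2
      have h3 : 3 * (k + 2) * r * ∑ x ∈ Y, hdDeg F x < 3 * (k + 2) * r * (2 * m) := by
        apply Nat.mul_lt_mul_of_pos_left h1
        positivity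
      have h4 : 3 * (k + 2) * r * (2 * m) = 6 * (k + 2) * r * m := by ring
      omega
  have hhigh : 3 * r * ∑ x ∈ X, hdDeg F x ^ 2 ≤ m * ∑ x ∈ X, hdDeg F x := by
    rw [mul_sum, mul_sum]
    apply sum_le_sum
    intro x hx
    rw [pow_two, ← mul_assoc]
    exact Nat.mul_le_mul_right _ (hdeg x (hXs hx))
  have hlowsum : 3 * r * ∑ x ∈ (Icc 1 n).filter (fun x => ¬ m ≤ 3 * (k + 2) * r * hdDeg F x),
      hdDeg F x ^ 2 ≤ m * m := by
    apply Nat.le_of_mul_le_mul_left (c := _) _ (show 0 < k + 2 by omega)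
    calc _ = 3 * (k + 2) * r *
          ∑ x ∈ (Icc 1 n).filter (fun x => ¬ m ≤ 3 * (k + 2) * r * hdDeg F x), hdDeg F x ^ 2 := by
            ring
      _ ≤ m * ∑ x ∈ (Icc 1 n).filter (fun x => ¬ m ≤ 3 * (k + 2) * r * hdDeg F x), hdDeg F x := by
        rw [mul_sum, mul_sum]
        apply sum_le_sum
        intro x hx
        rw [pow_two, ← mul_assoc]
        exact Nat.mul_le_mul_right _ (not_le.1 (mem_filter.1 hx).2).le
      _ ≤ m * ∑ x ∈ Icc 1 n, hdDeg F x := by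
        gcongr
        exact filter_subset _ _
      _ = (k + 2) * (m * m) := by
        rw [hd_sum_deg n (k + 2) F hFsub, hFcard]; ring
  have htot := sum_filter_add_sum_filter_not (Icc 1 n)
    (fun x => m ≤ 3 * (k + 2) * r * hdDeg F x) (fun x => hdDeg F x ^ 2)
  rw [← hX] at htot
  have hrn : r ≤ n := by
    have : 1 * r ≤ (36 * (k + 2) * (2 * (k + 2) + 1) * ((k + 2) + r)) * r := by
      gcongr
      have : 0 < 36 * (k + 2) * (2 * (k + 2) + 1) * ((k + 2) + r) := by positivity
      omega
    omega
  obtain ⟨F', hF's, hF'c, hlb⟩ := hd_lower n (k + 2) r m hrn hm2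
  have hcmp := hext F' hF's hF'c
  have e1 := hd_sum_sq n (k + 2) F hFsub
  have e2 := hd_sum_sq n (k + 2) F' hF's
  rw [hFcard] at e1
  rw [hF'c] at e2
  have hle : ∑ x ∈ Icc 1 n, hdDeg F' x ^ 2 ≤ ∑ x ∈ Icc 1 n, hdDeg F x ^ 2 := by omega
  have h5 := hlb.trans (Nat.mul_le_mul_left r hle)
  rw [← htot] at h5
  have h6 : m * ∑ x ∈ X, hdDeg F x < m * (2 * m) := Nat.mul_lt_mul_of_pos_left hXsum hm
  nlinarith

theorem high_degree_vertices_cover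
    (n k r m : ℕ) (hr : 2 ≤ r) (hk : 0 < k) (hn : 0 < n) (hm : 0 < m)
    (hbig : 36 * k * (2 * k + 1) * (k + r) * r < n)
    (hm1 : n.choose k - (n - r + 1).choose k < m)
    (hm2 : m ≤ n.choose k - (n - r).choose k)
    (F : Finset (Finset ℕ)) (hFsub : F ⊆ (Finset.Icc 1 n).powersetCard k)
    (hFcard : F.card = m)
    (hext : ∀ F' ⊆ (Finset.Icc 1 n).powersetCard k, F'.card = m → omegaF F' ≤ omegaF F)
    (hnostar : ∀ x ∈ Finset.Icc 1 n,
      F.filter (fun A => x ∈ A) ≠ ((Finset.Icc 1 n).powersetCard k).filter (fun A => x ∈ A)) :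
    ∀ A ∈ F,
      (A ∩ (Finset.Icc 1 n).filter
        (fun x => (m : ℚ) / (3 * (k : ℚ) * (r : ℚ)) ≤ ((F.filter (fun B => x ∈ B)).card : ℚ))).Nonempty := by
  intro A hA
  have hstar : ∀ x ∈ Finset.Icc 1 n, ∃ B ∈ (Finset.Icc 1 n).powersetCard k, x ∈ B ∧ B ∉ F := by
    intro x hx
    by_contra hcon
    push Not at hcon
    apply hnostar x hx
    ext B
    simp only [mem_filter]
    exact ⟨fun h => ⟨hFsub h.1, h.2⟩, fun h => ⟨hcon B h.1 h.2, h.2⟩⟩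
  have hAc := mem_powersetCard.1 (hFsub hA)
  by_contra hne
  rw [not_nonempty_iff_eq_empty] at hne
  have hlow : ∀ x ∈ A, 3 * k * r * hdDeg F x < m := by
    intro x hx
    by_contra hge
    rw [not_lt] at hge
    have hmem : x ∈ A ∩ (Finset.Icc 1 n).filter
        (fun x => (m : ℚ) / (3 * (k : ℚ) * (r : ℚ)) ≤
          ((F.filter (fun B => x ∈ B)).card : ℚ)) := by
      rw [mem_inter, mem_filter]
      refine ⟨hx, hAc.1 hx, ?_⟩
      have hpos : (0 : ℚ) < 3 * (k : ℚ) * (r : ℚ) := by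
        have h1 : 0 < 3 * k * r := by positivity
        exact_mod_cast h1
      rw [div_le_iff₀ hpos, mul_comm]
      exact_mod_cast hge
    rw [hne] at hmem
    simp at hmem
  obtain _ | _ | k := k
  · omega
  · obtain ⟨x, rfl⟩ := card_eq_one.1 hAc.2
    obtain ⟨B, hB, hxB, hBF⟩ := hstar x (hAc.1 (mem_singleton_self x))
    obtain ⟨y, rfl⟩ := card_eq_one.1 (mem_powersetCard.1 hB).2
    rw [mem_singleton] at hxB
    subst hxB
    exact hBF hA
  · exact hd_main n k r m hr hm hbig hm1 hm2 F hFsub hFcard hext hstar A hA hlow
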